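/- arXiv:1901.07437 — 3 statements merged into one kernel-verified Lean document; each statement's English description precedes it below -/
import Mathlib

section
/- Let Φ(y) = (1/k)·sin(k n₀·(y − p)) for y ∈ ℝ³. Then its Dirichlet trace d(ξ) = Φ(x(ξ)) and Neumann trace ν(ξ) = ∇Φ(x(ξ))·n(ξ) satisfy the zeroth-order planewave point-interpolation conditions at ξ = 0 up to first order: d(0) = 0, ∂₁d(0) = 0, ∂₂d(0) = 0, ν(0) = 1, ∂₁ν(0) = 0 and ∂₂ν(0) = 0. -/
noncomputable section

namespace Stmt0

/-- Euclidean dot product on `ℝ³`. -/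
def dot3 (a b : Fin 3 → ℝ) : ℝ := ∑ i, a i * b i

/-- Cross product on `ℝ³`. -/
def cross3 (a b : Fin 3 → ℝ) : Fin 3 → ℝ :=
  ![a 1 * b 2 - a 2 * b 1, a 2 * b 0 - a 0 * b 2, a 0 * b 1 - a 1 * b 0]

/-- Euclidean norm on `ℝ³`. -/
def enorm3 (a : Fin 3 → ℝ) : ℝ := Real.sqrt (dot3 a a)

/-- Partial derivative in the `i`-th coordinate direction of `ξ ∈ ℝ²`. -/
def pd {F : Type*} [NormedAddCommGroup F] [NormedSpace ℝ F]
    (i : Fin 2) (f : (Fin 2 → ℝ) → F) : (Fin 2 → ℝ) → F :=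
  fun ξ => fderiv ℝ f ξ (Pi.single i 1)

/-- The linear functional `b ↦ a · b`. -/
def dot3L (a : Fin 3 → ℝ) : (Fin 3 → ℝ) →L[ℝ] ℝ :=
  ∑ i, a i • ContinuousLinearMap.proj i

lemma dot3L_apply (a b : Fin 3 → ℝ) : dot3L a b = dot3 a b := by
  simp [dot3L, dot3]

lemma dot3_self_nonneg (a : Fin 3 → ℝ) : 0 ≤ dot3 a a :=
  Finset.sum_nonneg fun i _ => mul_self_nonneg (a i)

lemma dot3_smul_smul (c : ℝ) (a : Fin 3 → ℝ) : dot3 (c • a) (c • a) = c ^ 2 * dot3 a a := by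
  simp only [dot3, Fin.sum_univ_three, Pi.smul_apply, smul_eq_mul]
  ring

lemma dot3_sq_le (a b : Fin 3 → ℝ) : dot3 a b ^ 2 ≤ dot3 a a * dot3 b b := by
  have h := Finset.sum_mul_sq_le_sq_mul_sq Finset.univ a b
  simpa only [dot3, pow_two] using h

lemma dot3_self_normalize_le_one (a : Fin 3 → ℝ) :
    dot3 ((enorm3 a)⁻¹ • a) ((enorm3 a)⁻¹ • a) ≤ 1 := by
  rw [dot3_smul_smul, inv_pow, enorm3, Real.sq_sqrt (dot3_self_nonneg a)]
  exact inv_mul_le_one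

lemma dot3_self_normalize {a : Fin 3 → ℝ} (ha : a ≠ 0) :
    dot3 ((enorm3 a)⁻¹ • a) ((enorm3 a)⁻¹ • a) = 1 := by
  rw [dot3_smul_smul, inv_pow, enorm3, Real.sq_sqrt (dot3_self_nonneg a)]
  refine inv_mul_cancel₀ fun h => ha ?_
  funext i
  exact mul_self_eq_zero.mp
    ((Finset.sum_eq_zero_iff_of_nonneg fun i _ => mul_self_nonneg (a i)).mp h i
      (Finset.mem_univ i))

lemma dot3_smul_cross3_left (c : ℝ) (a b : Fin 3 → ℝ) : dot3 (c • cross3 a b) a = 0 := by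
  simp [dot3, cross3, Fin.sum_univ_three]
  ring

lemma dot3_smul_cross3_right (c : ℝ) (a b : Fin 3 → ℝ) : dot3 (c • cross3 a b) b = 0 := by
  simp [dot3, cross3, Fin.sum_univ_three]
  ring

lemma hasFDerivAt_planewave {k : ℝ} (hk : k ≠ 0) (a p y : Fin 3 → ℝ) :
    HasFDerivAt (fun y => (1 / k) * Real.sin (k * dot3 a (y - p)))
      (Real.cos (k * dot3 a (y - p)) • dot3L a) y := by
  have h := ((((dot3L a).hasFDerivAt.comp y
    ((hasFDerivAt_id y).sub_const p)).const_mul k).sin).const_mul (1 / k)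
  simp only [Function.comp_def, dot3L_apply, id] at h
  refine h.congr_fderiv ?_
  ext v
  simp
  field_simp

theorem statement0
    (k : ℝ) (hk : 0 < k)
    (x : (Fin 2 → ℝ) → (Fin 3 → ℝ)) (hx : ContDiff ℝ 2 x)
    (p : Fin 3 → ℝ) (hxp : x 0 = p)
    (e₁ e₂ : Fin 3 → ℝ) (he₁ : e₁ = pd 0 x 0) (he₂ : e₂ = pd 1 x 0)
    (hind : LinearIndependent ℝ ![e₁, e₂])
    (hcross : ∀ᶠ ξ in nhds (0 : Fin 2 → ℝ),
      cross3 (pd 0 x ξ) (pd 1 x ξ) ≠ 0)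
    (n : (Fin 2 → ℝ) → (Fin 3 → ℝ))
    (hn : ∀ ξ, n ξ = (enorm3 (cross3 (pd 0 x ξ) (pd 1 x ξ)))⁻¹ •
      cross3 (pd 0 x ξ) (pd 1 x ξ))
    (Φ : (Fin 3 → ℝ) → ℝ)
    (hΦ : ∀ y, Φ y = (1 / k) * Real.sin (k * dot3 (n 0) (y - p)))
    (d ν : (Fin 2 → ℝ) → ℝ)
    (hd : ∀ ξ, d ξ = Φ (x ξ))
    (hν : ∀ ξ, ν ξ = fderiv ℝ Φ (x ξ) (n ξ)) :
    d 0 = 0 ∧ pd 0 d 0 = 0 ∧ pd 1 d 0 = 0 ∧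
    ν 0 = 1 ∧ pd 0 ν 0 = 0 ∧ pd 1 ν 0 = 0 := by
  have hx0 : HasFDerivAt x (fderiv ℝ x 0) 0 :=
    (hx.differentiable (by norm_num) 0).hasFDerivAt
  have hΦ' (y) : HasFDerivAt Φ (Real.cos (k * dot3 (n 0) (y - p)) • dot3L (n 0)) y := by
    rw [funext hΦ]
    exact hasFDerivAt_planewave hk.ne' (n 0) p y
  have hzero : dot3 (n 0) (x 0 - p) = 0 := by simp [hxp, dot3]
  have hd' (v) : fderiv ℝ d 0 v = dot3 (n 0) (fderiv ℝ x 0 v) := by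
    rw [show d = Φ ∘ x from funext hd, ((hΦ' (x 0)).comp (0 : Fin 2 → ℝ) hx0).fderiv]
    simp [hzero, dot3L_apply]
  have hν' (ξ) : ν ξ = Real.cos (k * dot3 (n 0) (x ξ - p)) * dot3 (n 0) (n ξ) := by
    rw [hν, (hΦ' (x ξ)).fderiv]
    simp [dot3L_apply]
  have hn0 : dot3 (n 0) (n 0) = 1 := by
    rw [hn]
    exact dot3_self_normalize hcross.self_of_nhds
  have hν0 : ν 0 = 1 := by simp [hν', hzero, hn0]
  have hmax : IsLocalMax ν 0 := by
    refine Filter.Eventually.of_forall fun ξ => ?_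
    have hle : dot3 (n ξ) (n ξ) ≤ 1 := by
      rw [hn]
      exact dot3_self_normalize_le_one _
    have hdot : |dot3 (n 0) (n ξ)| ≤ 1 := by
      rw [← sq_le_one_iff_abs_le_one]
      exact (dot3_sq_le (n 0) (n ξ)).trans (by rwa [hn0, one_mul])
    rw [hν0, hν']
    refine (le_abs_self _).trans ?_
    rw [abs_mul]
    exact mul_le_one₀ (Real.abs_cos_le_one _) (abs_nonneg _) hdot
  refine ⟨by simp [hd, hΦ, hzero], ?_, ?_, hν0, ?_, ?_⟩
  · rw [pd, hd', hn]
    exact dot3_smul_cross3_left _ _ _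
  · rw [pd, hd', hn]
    exact dot3_smul_cross3_right _ _ _
  all_goals simp [pd, hmax.fderiv_eq_zero]

end Stmt0
end
end

section
/- Let Φ(y) = (2/k²)·√(g₂₂/g)·sin(k n₀·(y − p)/√2)·sin(k τ₁·(y − p)/√2) for y ∈ ℝ³. Then its Dirichlet trace d(ξ) = Φ(x(ξ)) and Neumann trace ν(ξ) = ∇Φ(x(ξ))·n(ξ) satisfy: d(0) = 0, ∂₁d(0) = 0, ∂₂d(0) = 0, ν(0) = 0, ∂₁ν(0) = 1 and ∂₂ν(0) = 0. Symmetrically, for Ψ(y) = (2/k²)·√(g₁₁/g)·sin(k n₀·(y − p)/√2)·sin(k τ₂·(y − p)/√2), the traces satisfy the analogous conditions with the roles of the indices 1 and 2 interchanged (in particular ∂₂(∇Ψ(x(·))·n(·))(0) = 1 and ∂₁(∇Ψ(x(·))·n(·))(0) = 0 while all trace values and first-order Dirichlet-trace derivatives at 0 vanish). -/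
noncomputable section

namespace Stmt1

/-- Euclidean dot product on `ℝ³`. -/
def dot3 (a b : Fin 3 → ℝ) : ℝ := ∑ i, a i * b i

/-- Cross product on `ℝ³`. -/
def cross3 (a b : Fin 3 → ℝ) : Fin 3 → ℝ :=
  ![a 1 * b 2 - a 2 * b 1, a 2 * b 0 - a 0 * b 2, a 0 * b 1 - a 1 * b 0]

/-- Euclidean norm on `ℝ³`. -/
def enorm3 (a : Fin 3 → ℝ) : ℝ := Real.sqrt (dot3 a a)

/-- Partial derivative in the `i`-th coordinate direction of `ξ ∈ ℝ²`. -/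
def pd {F : Type*} [NormedAddCommGroup F] [NormedSpace ℝ F]
    (i : Fin 2) (f : (Fin 2 → ℝ) → F) : (Fin 2 → ℝ) → F :=
  fun ξ => fderiv ℝ f ξ (Pi.single i 1)

/-- The functional `dot3 a` as a continuous linear map. -/
def dot3CLM (a : Fin 3 → ℝ) : (Fin 3 → ℝ) →L[ℝ] ℝ :=
  ∑ i, a i • ContinuousLinearMap.proj i

lemma dot3CLM_apply (a y : Fin 3 → ℝ) : dot3CLM a y = dot3 a y := by
  simp [dot3CLM, dot3]

lemma dot3_self_nonneg (a : Fin 3 → ℝ) : 0 ≤ dot3 a a :=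
  Finset.sum_nonneg fun i _ => mul_self_nonneg (a i)

lemma dot3_self_pos {a : Fin 3 → ℝ} (ha : a ≠ 0) : 0 < dot3 a a := by
  refine lt_of_le_of_ne (dot3_self_nonneg a) fun h => ha ?_
  funext i
  have := (Finset.sum_eq_zero_iff_of_nonneg
    (fun i _ => mul_self_nonneg (a i))).1 h.symm i (Finset.mem_univ i)
  exact mul_self_eq_zero.1 this

lemma dot3_zero_right (a : Fin 3 → ℝ) : dot3 a 0 = 0 := by simp [dot3]

lemma dot3_smul_left (c : ℝ) (a b : Fin 3 → ℝ) : dot3 (c • a) b = c * dot3 a b := by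
  simp [dot3, Finset.mul_sum, mul_assoc]

lemma dot3_smul_right (c : ℝ) (a b : Fin 3 → ℝ) : dot3 a (c • b) = c * dot3 a b := by
  simp [dot3, Finset.mul_sum, mul_left_comm]

lemma dot3_sub_left (a b c : Fin 3 → ℝ) : dot3 (a - b) c = dot3 a c - dot3 b c := by
  simp [dot3, sub_mul, Finset.sum_sub_distrib]

lemma dot3_comm (a b : Fin 3 → ℝ) : dot3 a b = dot3 b a := by
  simp [dot3, mul_comm]

lemma dot3_cross3_left (a b : Fin 3 → ℝ) : dot3 (cross3 a b) a = 0 := by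
  simp [dot3, cross3, Fin.sum_univ_three]; ring

lemma dot3_cross3_right (a b : Fin 3 → ℝ) : dot3 (cross3 a b) b = 0 := by
  simp [dot3, cross3, Fin.sum_univ_three]; ring

/-- Lagrange's identity. -/
lemma dot3_cross3_self (a b : Fin 3 → ℝ) :
    dot3 (cross3 a b) (cross3 a b) = dot3 a a * dot3 b b - dot3 a b ^ 2 := by
  simp [dot3, cross3, Fin.sum_univ_three]; ring

lemma dot3_normalize_self {a : Fin 3 → ℝ} (ha : a ≠ 0) :
    dot3 ((enorm3 a)⁻¹ • a) ((enorm3 a)⁻¹ • a) = 1 := by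
  have h := dot3_self_pos ha
  have h2 : enorm3 a * enorm3 a = dot3 a a := Real.mul_self_sqrt h.le
  have h3 : enorm3 a ≠ 0 := (Real.sqrt_pos.2 h).ne'
  rw [dot3_smul_left, dot3_smul_right, ← h2]
  field_simp

lemma differentiableAt_cross3 {E : Type*} [NormedAddCommGroup E] [NormedSpace ℝ E]
    {u v : E → Fin 3 → ℝ} {ξ : E} (hu : DifferentiableAt ℝ u ξ) (hv : DifferentiableAt ℝ v ξ) :
    DifferentiableAt ℝ (fun η => cross3 (u η) (v η)) ξ := by
  have hu' := differentiableAt_pi.1 hu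
  have hv' := differentiableAt_pi.1 hv
  refine differentiableAt_pi.2 fun i => ?_
  fin_cases i
  · exact ((hu' 1).mul (hv' 2)).sub ((hu' 2).mul (hv' 1))
  · exact ((hu' 2).mul (hv' 0)).sub ((hu' 0).mul (hv' 2))
  · exact ((hu' 0).mul (hv' 1)).sub ((hu' 1).mul (hv' 0))

lemma differentiableAt_normalize {E : Type*} [NormedAddCommGroup E] [NormedSpace ℝ E]
    {u : E → Fin 3 → ℝ} {ξ : E} (hu : DifferentiableAt ℝ u ξ) (h0 : u ξ ≠ 0) :
    DifferentiableAt ℝ (fun η => (enorm3 (u η))⁻¹ • u η) ξ := by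
  have hu' := differentiableAt_pi.1 hu
  have hd : DifferentiableAt ℝ (fun η => dot3 (u η) (u η)) ξ :=
    DifferentiableAt.fun_sum fun i _ => (hu' i).mul (hu' i)
  have hpos := dot3_self_pos h0
  exact ((hd.sqrt hpos.ne').inv (Real.sqrt_pos.2 hpos).ne').smul hu

lemma differentiable_pd {x : (Fin 2 → ℝ) → Fin 3 → ℝ} (hx : ContDiff ℝ 2 x) (i : Fin 2) :
    Differentiable ℝ (pd i x) :=
  ((hx.fderiv_right (m := 1) (by norm_num)).differentiable one_ne_zero).clm_apply
    (differentiable_const _)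

/-- Cauchy data at `0` of a product of two plane sine waves, one in the normal direction `n 0`
and one in the direction `T`. -/
lemma traces_sin_mul_sin {k C : ℝ} (hk : k ≠ 0) {x n : (Fin 2 → ℝ) → Fin 3 → ℝ}
    (hx : DifferentiableAt ℝ x 0) (hn : DifferentiableAt ℝ n 0)
    (hunit : dot3 (n 0) (n 0) = 1) (horth : ∀ i, dot3 (n 0) (pd i x 0) = 0)
    {T : Fin 3 → ℝ} {Φ : (Fin 3 → ℝ) → ℝ}
    (hΦ : ∀ y, Φ y = (2 / k ^ 2) * C *
      Real.sin (k * dot3 (n 0) (y - x 0) / Real.sqrt 2) *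
      Real.sin (k * dot3 T (y - x 0) / Real.sqrt 2))
    {d ν : (Fin 2 → ℝ) → ℝ}
    (hd : ∀ ξ, d ξ = Φ (x ξ)) (hν : ∀ ξ, ν ξ = fderiv ℝ Φ (x ξ) (n ξ)) :
    d 0 = 0 ∧ (∀ i, pd i d 0 = 0) ∧ ν 0 = 0 ∧
      ∀ i, pd i ν 0 = C * dot3 T (pd i x 0) := by
  set c : ℝ := (2 / k ^ 2) * C with hc
  set s : ℝ := k / Real.sqrt 2 with hs
  have hs2 : c * (s * s) = C := by
    have : Real.sqrt 2 * Real.sqrt 2 = 2 := Real.mul_self_sqrt (by norm_num)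
    have h2 : s * s = k ^ 2 / 2 := by rw [hs, div_mul_div_comm, this, sq]
    rw [h2, hc]; field_simp
  let A := s • dot3CLM (n 0)
  let B := s • dot3CLM T
  have hA : ∀ y, k * dot3 (n 0) y / Real.sqrt 2 = A y := fun y => by
    simp [A, dot3CLM_apply, hs]; ring
  have hB : ∀ y, k * dot3 T y / Real.sqrt 2 = B y := fun y => by
    simp [B, dot3CLM_apply, hs]; ring
  obtain rfl : Φ = fun y => c * Real.sin (A (y - x 0)) * Real.sin (B (y - x 0)) := by
    funext y; rw [hΦ, hA, hB]
  have hΦ' : ∀ y v, fderiv ℝ (fun y => c * Real.sin (A (y - x 0)) * Real.sin (B (y - x 0))) y v =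
      c * (Real.sin (A (y - x 0)) * Real.cos (B (y - x 0)) * B v +
        Real.sin (B (y - x 0)) * Real.cos (A (y - x 0)) * A v) := fun y v => by
    have h1 : HasFDerivAt (fun y => A (y - x 0)) A y :=
      A.hasFDerivAt.comp y ((hasFDerivAt_id y).sub_const (x 0))
    have h2 : HasFDerivAt (fun y => B (y - x 0)) B y :=
      B.hasFDerivAt.comp y ((hasFDerivAt_id y).sub_const (x 0))
    rw [((h1.sin.const_mul c).fun_mul h2.sin).fderiv]
    simp; ring
  have hX := hx.hasFDerivAt
  have hN := hn.hasFDerivAt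
  have hAx : HasFDerivAt (fun ξ => A (x ξ - x 0)) (A.comp (fderiv ℝ x 0)) 0 :=
    A.hasFDerivAt.comp 0 (hX.sub_const (x 0))
  have hBx : HasFDerivAt (fun ξ => B (x ξ - x 0)) (B.comp (fderiv ℝ x 0)) 0 :=
    B.hasFDerivAt.comp 0 (hX.sub_const (x 0))
  have hAn : HasFDerivAt (fun ξ => A (n ξ)) (A.comp (fderiv ℝ n 0)) 0 :=
    A.hasFDerivAt.comp 0 hN
  have hBn : HasFDerivAt (fun ξ => B (n ξ)) (B.comp (fderiv ℝ n 0)) 0 :=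
    B.hasFDerivAt.comp 0 hN
  refine ⟨by simp [hd], fun i => ?_, by rw [hν, hΦ']; simp, fun i => ?_⟩
  · rw [pd, funext hd]
    beta_reduce
    rw [((hAx.sin.const_mul c).fun_mul hBx.sin).fderiv]
    simp
  · have hAi : A (fderiv ℝ x 0 (Pi.single i 1)) = 0 := by
      have := horth i
      rw [pd] at this
      simp [A, dot3CLM_apply, this]
    have hAn0 : A (n 0) = s := by simp [A, dot3CLM_apply, hunit]
    have hBi : B (fderiv ℝ x 0 (Pi.single i 1)) = s * dot3 T (pd i x 0) := by
      simp [B, dot3CLM_apply, pd]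
    rw [pd, funext fun ξ => (hν ξ).trans (hΦ' _ _),
      ((((hAx.sin.fun_mul hBx.cos).fun_mul hBn).fun_add
        ((hBx.sin.fun_mul hAx.cos).fun_mul hAn)).const_mul c).fderiv]
    simp [hAi, hAn0, hBi]
    rw [← hs2]; ring

lemma sqrt_div_mul_sqrt_div {g h : ℝ} (hg : 0 < g) (hh : 0 < h) :
    Real.sqrt (h / g) * Real.sqrt (g / h) = 1 := by
  rw [← Real.sqrt_mul (by positivity), div_mul_div_cancel₀ hg.ne', div_self hh.ne', Real.sqrt_one]

/-- `τ = √(g / g_bb) g⁻¹ (g_bb a - g_ab b)` is, up to scaling, the dual basis vector of `a`. -/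
lemma sqrt_mul_dot3_dual {a b : Fin 3 → ℝ} {g : ℝ} (hb : 0 < dot3 b b) (hg : 0 < g)
    (hgram : g = dot3 a a * dot3 b b - dot3 a b ^ 2) :
    Real.sqrt (dot3 b b / g) * dot3 ((Real.sqrt (g / dot3 b b) / g) •
      (dot3 b b • a - dot3 a b • b)) a = 1 ∧
    Real.sqrt (dot3 b b / g) * dot3 ((Real.sqrt (g / dot3 b b) / g) •
      (dot3 b b • a - dot3 a b • b)) b = 0 := by
  have h := sqrt_div_mul_sqrt_div hg hb
  simp only [dot3_smul_left, dot3_sub_left]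
  constructor
  · rw [dot3_comm b a, show dot3 b b * dot3 a a - dot3 a b * dot3 a b = g by rw [hgram]; ring,
      div_mul_cancel₀ _ hg.ne', h]
  · ring

theorem statement1
    (k : ℝ) (hk : 0 < k)
    (x : (Fin 2 → ℝ) → (Fin 3 → ℝ)) (hx : ContDiff ℝ 2 x)
    (p : Fin 3 → ℝ) (hxp : x 0 = p)
    (e₁ e₂ : Fin 3 → ℝ) (he₁ : e₁ = pd 0 x 0) (he₂ : e₂ = pd 1 x 0)
    (hind : LinearIndependent ℝ ![e₁, e₂])
    (g11 g12 g22 g : ℝ)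
    (hg11 : g11 = dot3 e₁ e₁) (hg12 : g12 = dot3 e₁ e₂)
    (hg22 : g22 = dot3 e₂ e₂) (hg : g = g11 * g22 - g12 ^ 2)
    (hcross : ∀ᶠ ξ in nhds (0 : Fin 2 → ℝ),
      cross3 (pd 0 x ξ) (pd 1 x ξ) ≠ 0)
    (n : (Fin 2 → ℝ) → (Fin 3 → ℝ))
    (hn : ∀ ξ, n ξ = (enorm3 (cross3 (pd 0 x ξ) (pd 1 x ξ)))⁻¹ •
      cross3 (pd 0 x ξ) (pd 1 x ξ))
    (τ₁ τ₂ : Fin 3 → ℝ)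
    (hτ₁ : τ₁ = (Real.sqrt (g / g22) / g) • (g22 • e₁ - g12 • e₂))
    (hτ₂ : τ₂ = (Real.sqrt (g / g11) / g) • (g11 • e₂ - g12 • e₁))
    (Φ Ψ : (Fin 3 → ℝ) → ℝ)
    (hΦ : ∀ y, Φ y = (2 / k ^ 2) * Real.sqrt (g22 / g) *
      Real.sin (k * dot3 (n 0) (y - p) / Real.sqrt 2) *
      Real.sin (k * dot3 τ₁ (y - p) / Real.sqrt 2))
    (hΨ : ∀ y, Ψ y = (2 / k ^ 2) * Real.sqrt (g11 / g) *
      Real.sin (k * dot3 (n 0) (y - p) / Real.sqrt 2) *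
      Real.sin (k * dot3 τ₂ (y - p) / Real.sqrt 2))
    (dΦ νΦ dΨ νΨ : (Fin 2 → ℝ) → ℝ)
    (hdΦ : ∀ ξ, dΦ ξ = Φ (x ξ)) (hνΦ : ∀ ξ, νΦ ξ = fderiv ℝ Φ (x ξ) (n ξ))
    (hdΨ : ∀ ξ, dΨ ξ = Ψ (x ξ)) (hνΨ : ∀ ξ, νΨ ξ = fderiv ℝ Ψ (x ξ) (n ξ)) :
    (dΦ 0 = 0 ∧ pd 0 dΦ 0 = 0 ∧ pd 1 dΦ 0 = 0 ∧
     νΦ 0 = 0 ∧ pd 0 νΦ 0 = 1 ∧ pd 1 νΦ 0 = 0) ∧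
    (dΨ 0 = 0 ∧ pd 0 dΨ 0 = 0 ∧ pd 1 dΨ 0 = 0 ∧
     νΨ 0 = 0 ∧ pd 0 νΨ 0 = 0 ∧ pd 1 νΨ 0 = 1) := by
  subst hxp he₁ he₂
  have hc0 : cross3 (pd 0 x 0) (pd 1 x 0) ≠ 0 := hcross.self_of_nhds
  have hgram : g = dot3 (pd 0 x 0) (pd 0 x 0) * dot3 (pd 1 x 0) (pd 1 x 0) -
      dot3 (pd 0 x 0) (pd 1 x 0) ^ 2 := by rw [hg, hg11, hg12, hg22]
  have hgpos : 0 < g := by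
    rw [hgram, ← dot3_cross3_self]
    exact dot3_self_pos hc0
  have hpos1 : 0 < dot3 (pd 0 x 0) (pd 0 x 0) := dot3_self_pos (by simpa using hind.ne_zero 0)
  have hpos2 : 0 < dot3 (pd 1 x 0) (pd 1 x 0) := dot3_self_pos (by simpa using hind.ne_zero 1)
  have hxd : DifferentiableAt ℝ x 0 := hx.differentiable two_ne_zero 0
  have hnd : DifferentiableAt ℝ n 0 := by
    rw [funext hn]
    exact differentiableAt_normalize
      (differentiableAt_cross3 (differentiable_pd hx 0 0) (differentiable_pd hx 1 0)) hc0
  have hunit : dot3 (n 0) (n 0) = 1 := by rw [hn]; exact dot3_normalize_self hc0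
  have horth : ∀ i, dot3 (n 0) (pd i x 0) = 0 := by
    intro i
    rw [hn, dot3_smul_left]
    fin_cases i
    · exact mul_eq_zero_of_right _ (dot3_cross3_left _ _)
    · exact mul_eq_zero_of_right _ (dot3_cross3_right _ _)
  obtain ⟨a1, a2, a3, a4⟩ := traces_sin_mul_sin hk.ne' hxd hnd hunit horth hΦ hdΦ hνΦ
  obtain ⟨b1, b2, b3, b4⟩ := traces_sin_mul_sin hk.ne' hxd hnd hunit horth hΨ hdΨ hνΨ
  have hτ1 := sqrt_mul_dot3_dual hpos2 hgpos hgram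
  have hτ2 := sqrt_mul_dot3_dual (a := pd 1 x 0) hpos1 hgpos
    (by rw [hgram, dot3_comm (pd 1 x 0) (pd 0 x 0)]; ring)
  rw [dot3_comm (pd 1 x 0) (pd 0 x 0)] at hτ2
  subst hg11 hg12 hg22 hτ₁ hτ₂
  exact ⟨⟨a1, a2 0, a2 1, a3, (a4 0).trans hτ1.1, (a4 1).trans hτ1.2⟩,
    ⟨b1, b2 0, b2 1, b3, (b4 0).trans hτ2.2, (b4 1).trans hτ2.1⟩⟩

end Stmt1
end
end

section
/- Define Φ²₍₁,₀₎(y) = (2/k²)·√(g₂₂/g)·sin(k n₀·(y−p)/√2)·sin(k τ₁·(y−p)/√2) and Φ²₍₀,₁₎(y) = (2/k²)·√(g₁₁/g)·sin(k n₀·(y−p)/√2)·sin(k τ₂·(y−p)/√2), and let Φ(y) = (1/k)·√(g₂₂/g)·sin(k τ₁·(y − p)) − ((g₁₂M − g₂₂L)/g)·Φ²₍₁,₀₎(y) − ((g₁₂N − g₂₂M)/g)·Φ²₍₀,₁₎(y). Then its Dirichlet trace d(ξ) = Φ(x(ξ)) and Neumann trace ν(ξ) = ∇Φ(x(ξ))·n(ξ)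 satisfy: d(0) = 0, ∂₁d(0) = 1, ∂₂d(0) = 0, ν(0) = 0, ∂₁ν(0) = 0 and ∂₂ν(0) = 0. Symmetrically, Ψ(y) = (1/k)·√(g₁₁/g)·sin(k τ₂·(y − p)) − ((g₁₂L − g₁₁M)/g)·Φ²₍₁,₀₎(y) − ((g₁₂M − g₁₁N)/g)·Φ²₍₀,₁₎(y) satisfies the analogous conditions with ∂₂(Ψ∘x)(0) = 1, all other trace values and first-order trace derivatives at 0 being zero. -/
noncomputable section

namespace Stmt3

/-- Euclidean dot product on `ℝ³`. -/
def dot3 (a b : Fin 3 → ℝ) : ℝ := ∑ i, a i * b i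

/-- Cross product on `ℝ³`. -/
def cross3 (a b : Fin 3 → ℝ) : Fin 3 → ℝ :=
  ![a 1 * b 2 - a 2 * b 1, a 2 * b 0 - a 0 * b 2, a 0 * b 1 - a 1 * b 0]

/-- Euclidean norm on `ℝ³`. -/
def enorm3 (a : Fin 3 → ℝ) : ℝ := Real.sqrt (dot3 a a)

/-- Partial derivative in the `i`-th coordinate direction of `ξ ∈ ℝ²`. -/
def pd {F : Type*} [NormedAddCommGroup F] [NormedSpace ℝ F]
    (i : Fin 2) (f : (Fin 2 → ℝ) → F) : (Fin 2 → ℝ) → F :=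
  fun ξ => fderiv ℝ f ξ (Pi.single i 1)

theorem dot3_eq (a b : Fin 3 → ℝ) : dot3 a b = a 0 * b 0 + a 1 * b 1 + a 2 * b 2 := by
  simp [dot3, Fin.sum_univ_three]

theorem dot3_cross3_left (a b : Fin 3 → ℝ) : dot3 (cross3 a b) a = 0 := by
  simp [dot3_eq, cross3]; ring

theorem dot3_cross3_right (a b : Fin 3 → ℝ) : dot3 (cross3 a b) b = 0 := by
  simp [dot3_eq, cross3]; ring

theorem dot3_smul_left (r : ℝ) (a b : Fin 3 → ℝ) : dot3 (r • a) b = r * dot3 a b := by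
  simp [dot3_eq]; ring

theorem dot3_sub_left (a b c : Fin 3 → ℝ) : dot3 (a - b) c = dot3 a c - dot3 b c := by
  simp [dot3_eq]; ring

theorem dot3_comm (a b : Fin 3 → ℝ) : dot3 a b = dot3 b a := by
  simp [dot3_eq]; ring

theorem dot3_self_pos {a : Fin 3 → ℝ} (ha : a ≠ 0) : 0 < dot3 a a := by
  rw [dot3_eq]
  by_contra! h
  apply ha
  ext i
  fin_cases i <;> simp <;> nlinarith [mul_self_nonneg (a 0), mul_self_nonneg (a 1),
    mul_self_nonneg (a 2)]

/-- Lagrange's identity. -/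
theorem dot3_cross3_self (a b : Fin 3 → ℝ) :
    dot3 (cross3 a b) (cross3 a b) = dot3 a a * dot3 b b - dot3 a b ^ 2 := by
  simp [dot3_eq, cross3]; ring

theorem dot3_normalize_self {a : Fin 3 → ℝ} (ha : a ≠ 0) :
    dot3 ((enorm3 a)⁻¹ • a) ((enorm3 a)⁻¹ • a) = 1 := by
  have h := dot3_self_pos ha
  have h2 : enorm3 a ≠ 0 := (Real.sqrt_pos.2 h).ne'
  have h3 : enorm3 a * enorm3 a = dot3 a a := Real.mul_self_sqrt h.le
  rw [dot3_smul_left, dot3_comm, dot3_smul_left, ← h3]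
  field_simp

section Calculus

variable {E : Type*} [NormedAddCommGroup E] [NormedSpace ℝ E]

theorem differentiableAt_dot3 {u v : E → Fin 3 → ℝ} {z : E}
    (hu : DifferentiableAt ℝ u z) (hv : DifferentiableAt ℝ v z) :
    DifferentiableAt ℝ (fun ξ => dot3 (u ξ) (v ξ)) z := by
  rw [differentiableAt_pi] at hu hv
  simp only [dot3_eq]
  exact (((hu 0).mul (hv 0)).add ((hu 1).mul (hv 1))).add ((hu 2).mul (hv 2))

theorem differentiableAt_cross3 {u v : E → Fin 3 → ℝ} {z : E}
    (hu : DifferentiableAt ℝ u z) (hv : DifferentiableAt ℝ v z) :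
    DifferentiableAt ℝ (fun ξ => cross3 (u ξ) (v ξ)) z := by
  rw [differentiableAt_pi] at hu hv ⊢
  intro i
  fin_cases i
  · exact ((hu 1).mul (hv 2)).sub ((hu 2).mul (hv 1))
  · exact ((hu 2).mul (hv 0)).sub ((hu 0).mul (hv 2))
  · exact ((hu 0).mul (hv 1)).sub ((hu 1).mul (hv 0))

theorem differentiableAt_normalize {u : E → Fin 3 → ℝ} {z : E}
    (hu : DifferentiableAt ℝ u z) (h0 : u z ≠ 0) :
    DifferentiableAt ℝ (fun ξ => (enorm3 (u ξ))⁻¹ • u ξ) z := by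
  have h := dot3_self_pos h0
  exact (((differentiableAt_dot3 hu hu).sqrt h.ne').inv (Real.sqrt_pos.2 h).ne').smul hu

theorem hasDerivAt_dot3 {u v : ℝ → Fin 3 → ℝ} {u' v' : Fin 3 → ℝ} {t : ℝ}
    (hu : HasDerivAt u u' t) (hv : HasDerivAt v v' t) :
    HasDerivAt (fun s => dot3 (u s) (v s)) (dot3 u' (v t) + dot3 (u t) v') t := by
  rw [hasDerivAt_pi] at hu hv
  simp only [dot3_eq]
  refine ((((hu 0).mul (hv 0)).add ((hu 1).mul (hv 1))).add ((hu 2).mul (hv 2))).congr_deriv ?_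
  ring

theorem hasDerivAt_line {F : Type*} [NormedAddCommGroup F] [NormedSpace ℝ F] {f : E → F} {z : E}
    (hf : DifferentiableAt ℝ f z) (v : E) :
    HasDerivAt (fun t : ℝ => f (z + t • v)) (fderiv ℝ f z v) 0 :=
  hf.hasFDerivAt.hasLineDerivAt v

theorem fderiv_dot3_apply {u v : E → Fin 3 → ℝ} {z : E}
    (hu : DifferentiableAt ℝ u z) (hv : DifferentiableAt ℝ v z) (w : E) :
    fderiv ℝ (fun ξ => dot3 (u ξ) (v ξ)) z w =
      dot3 (fderiv ℝ u z w) (v z) + dot3 (u z) (fderiv ℝ v z w) := by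
  have h := hasDerivAt_dot3 (hasDerivAt_line hu w) (hasDerivAt_line hv w)
  simpa using (hasDerivAt_line (differentiableAt_dot3 hu hv) w).unique h

end Calculus

/-- A plane sine wave through `p` with a correction by two products of sine waves. -/
def waveSum (p m a b c : Fin 3 → ℝ) (k κ α P Q : ℝ) (y : Fin 3 → ℝ) : ℝ :=
  α * Real.sin (k * dot3 a (y - p))
    - P * (Real.sin (κ * dot3 m (y - p)) * Real.sin (κ * dot3 b (y - p)))
    - Q * (Real.sin (κ * dot3 m (y - p)) * Real.sin (κ * dot3 c (y - p)))

section WaveSum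

variable (p m a b c : Fin 3 → ℝ) (k κ α P Q : ℝ)

theorem waveSum_self : waveSum p m a b c k κ α P Q p = 0 := by
  simp [waveSum, dot3_eq]

theorem hasDerivAt_sin_mul_dot3 {y : ℝ → Fin 3 → ℝ} {y' : Fin 3 → ℝ} {t : ℝ}
    (hy : HasDerivAt y y' t) :
    HasDerivAt (fun s => Real.sin (k * dot3 a (y s - p)))
      (Real.cos (k * dot3 a (y t - p)) * (k * dot3 a y')) t := by
  have h := hasDerivAt_dot3 (hasDerivAt_const t a) (hy.sub_const p)
  convert (h.const_mul k).sin using 1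
  simp [dot3_eq]

theorem hasDerivAt_cos_mul_dot3 {y : ℝ → Fin 3 → ℝ} {y' : Fin 3 → ℝ} {t : ℝ}
    (hy : HasDerivAt y y' t) :
    HasDerivAt (fun s => Real.cos (k * dot3 a (y s - p)))
      (-Real.sin (k * dot3 a (y t - p)) * (k * dot3 a y')) t := by
  have h := hasDerivAt_dot3 (hasDerivAt_const t a) (hy.sub_const p)
  convert (h.const_mul k).cos using 1
  simp [dot3_eq]

theorem differentiable_waveSum : Differentiable ℝ (waveSum p m a b c k κ α P Q) := by
  unfold waveSum
  simp only [dot3_eq]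
  fun_prop

theorem fderiv_waveSum_apply (y v : Fin 3 → ℝ) :
    fderiv ℝ (waveSum p m a b c k κ α P Q) y v =
      α * (Real.cos (k * dot3 a (y - p)) * (k * dot3 a v))
      - P * (Real.cos (κ * dot3 m (y - p)) * (κ * dot3 m v) * Real.sin (κ * dot3 b (y - p))
        + Real.sin (κ * dot3 m (y - p)) * (Real.cos (κ * dot3 b (y - p)) * (κ * dot3 b v)))
      - Q * (Real.cos (κ * dot3 m (y - p)) * (κ * dot3 m v) * Real.sin (κ * dot3 c (y - p))
        + Real.sin (κ * dot3 m (y - p)) * (Real.cos (κ * dot3 c (y - p)) * (κ * dot3 c v))) := by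
  have hl : HasDerivAt (fun t : ℝ => y + t • v) v 0 := by
    simpa using ((hasDerivAt_id (0 : ℝ)).smul_const v).const_add y
  have hm := hasDerivAt_sin_mul_dot3 p m κ hl
  have h := (((hasDerivAt_sin_mul_dot3 p a k hl).const_mul α).sub
    ((hm.mul (hasDerivAt_sin_mul_dot3 p b κ hl)).const_mul P)).sub
    ((hm.mul (hasDerivAt_sin_mul_dot3 p c κ hl)).const_mul Q)
  simpa using (hasDerivAt_line (differentiable_waveSum p m a b c k κ α P Q y) v).unique h

variable {E : Type*} [NormedAddCommGroup E] [NormedSpace ℝ E]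
  {x n : E → Fin 3 → ℝ} {z : E}

theorem fderiv_waveSum_comp_apply (hx : DifferentiableAt ℝ x z) (w : E) :
    fderiv ℝ (fun ξ => waveSum p m a b c k κ α P Q (x ξ)) z w =
      fderiv ℝ (waveSum p m a b c k κ α P Q) (x z) (fderiv ℝ x z w) := by
  have h := fderiv_comp z (differentiable_waveSum p m a b c k κ α P Q (x z)) hx
  exact congrArg (fun L => L w) h

theorem fderiv_self_waveSum_apply (v : Fin 3 → ℝ) :
    fderiv ℝ (waveSum p m a b c k κ α P Q) p v = α * k * dot3 a v := by
  have h (u : Fin 3 → ℝ) : dot3 u 0 = 0 := by simp [dot3_eq]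
  simp [fderiv_waveSum_apply, h]
  ring

theorem fderiv_neumann_waveSum_apply (hx : DifferentiableAt ℝ x z) (hn : DifferentiableAt ℝ n z)
    (hp : x z = p) (w : E) :
    fderiv ℝ (fun ξ => fderiv ℝ (waveSum p m a b c k κ α P Q) (x ξ) (n ξ)) z w =
      α * k * dot3 a (fderiv ℝ n z w)
      - P * κ ^ 2 * (dot3 m (n z) * dot3 b (fderiv ℝ x z w)
        + dot3 m (fderiv ℝ x z w) * dot3 b (n z))
      - Q * κ ^ 2 * (dot3 m (n z) * dot3 c (fderiv ℝ x z w)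
        + dot3 m (fderiv ℝ x z w) * dot3 c (n z)) := by
  have hd : DifferentiableAt ℝ
      (fun ξ => fderiv ℝ (waveSum p m a b c k κ α P Q) (x ξ) (n ξ)) z := by
    simp only [fderiv_waveSum_apply]
    have h₁ (u : Fin 3 → ℝ) : DifferentiableAt ℝ (fun ξ => dot3 u (x ξ - p)) z :=
      differentiableAt_dot3 (differentiableAt_const u) (hx.sub_const p)
    have h₂ (u : Fin 3 → ℝ) : DifferentiableAt ℝ (fun ξ => dot3 u (n ξ)) z :=
      differentiableAt_dot3 (differentiableAt_const u) hn
    have h₁a := h₁ a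
    have h₁b := h₁ b
    have h₁c := h₁ c
    have h₁m := h₁ m
    have h₂a := h₂ a
    have h₂b := h₂ b
    have h₂c := h₂ c
    have h₂m := h₂ m
    fun_prop
  have hX := hasDerivAt_line hx w
  have hN (u : Fin 3 → ℝ) (r : ℝ) :=
    (hasDerivAt_dot3 (hasDerivAt_const (0 : ℝ) u) (hasDerivAt_line hn w)).const_mul r
  have hs (u : Fin 3 → ℝ) (r : ℝ) := hasDerivAt_sin_mul_dot3 p u r hX
  have hc (u : Fin 3 → ℝ) (r : ℝ) := hasDerivAt_cos_mul_dot3 p u r hX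
  have hprod (u : Fin 3 → ℝ) := (((hc m κ).mul (hN m κ)).mul (hs u κ)).add
    ((hs m κ).mul ((hc u κ).mul (hN u κ)))
  have h := ((((hc a k).mul (hN a k)).const_mul α).sub ((hprod b).const_mul P)).sub
    ((hprod c).const_mul Q)
  have hline := hasDerivAt_line hd w
  simp only [fderiv_waveSum_apply] at hline ⊢
  rw [hline.unique h]
  have h0 (u : Fin 3 → ℝ) : dot3 u 0 = 0 := by simp [dot3_eq]
  have hl0 (u : Fin 3 → ℝ) : dot3 0 u = 0 := by simp [dot3_eq]
  simp [hp, h0, hl0]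
  ring

end WaveSum

theorem pd_comm {F : Type*} [NormedAddCommGroup F] [NormedSpace ℝ F] {f : (Fin 2 → ℝ) → F}
    (hf : ContDiff ℝ 2 f) (i j : Fin 2) (ξ : Fin 2 → ℝ) :
    pd i (pd j f) ξ = pd j (pd i f) ξ := by
  have hd : Differentiable ℝ (fderiv ℝ f) :=
    (hf.fderiv_right (m := 1) (by norm_num)).differentiable (by norm_num)
  have hs : IsSymmSndFDerivAt ℝ f ξ := hf.contDiffAt.isSymmSndFDerivAt (by simp)
  have h (i j : Fin 2) : pd i (pd j f) ξ =
      fderiv ℝ (fderiv ℝ f) ξ (Pi.single i 1) (Pi.single j 1) := by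
    unfold pd
    rw [fderiv_clm_apply (hd ξ) (differentiableAt_const _)]
    simp
  rw [h, h, hs.eq]

theorem differentiable_pd {F : Type*} [NormedAddCommGroup F] [NormedSpace ℝ F]
    {f : (Fin 2 → ℝ) → F} (hf : ContDiff ℝ 2 f) (i : Fin 2) : Differentiable ℝ (pd i f) := by
  have hd : Differentiable ℝ (fderiv ℝ f) :=
    (hf.fderiv_right (m := 1) (by norm_num)).differentiable (by norm_num)
  exact hd.clm_apply (differentiable_const _)

/-- Weingarten relation: differentiating the orthogonality of a normal field `n` and a tangent
field `v`. -/
theorem dot3_fderiv_of_orthogonal {v n : (Fin 2 → ℝ) → Fin 3 → ℝ} {z : Fin 2 → ℝ}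
    (hv : DifferentiableAt ℝ v z) (hn : DifferentiableAt ℝ n z)
    (h : ∀ ξ, dot3 (v ξ) (n ξ) = 0) (w : Fin 2 → ℝ) :
    dot3 (v z) (fderiv ℝ n z w) = -dot3 (fderiv ℝ v z w) (n z) := by
  have h1 := fderiv_dot3_apply hv hn w
  simp only [h] at h1
  simp at h1
  linarith

theorem sqrt_mul_dual_dot3 {c g : ℝ} (hc : 0 < c) (hg : 0 < g) (d : ℝ) (u v w : Fin 3 → ℝ) :
    Real.sqrt (c / g) * dot3 ((Real.sqrt (g / c) / g) • (c • u - d • v)) w =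
      (c * dot3 u w - d * dot3 v w) / g := by
  have h : Real.sqrt (c / g) * Real.sqrt (g / c) = 1 := by
    rw [← Real.sqrt_mul (by positivity)]
    field_simp
    simp
  rw [dot3_smul_left, dot3_sub_left, dot3_smul_left, dot3_smul_left]
  linear_combination ((c * dot3 u w - d * dot3 v w) / g) * h

theorem statement3
    (k : ℝ) (hk : 0 < k)
    (x : (Fin 2 → ℝ) → (Fin 3 → ℝ)) (hx : ContDiff ℝ 2 x)
    (p : Fin 3 → ℝ) (hxp : x 0 = p)
    (e₁ e₂ : Fin 3 → ℝ) (he₁ : e₁ = pd 0 x 0) (he₂ : e₂ = pd 1 x 0)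
    (hind : LinearIndependent ℝ ![e₁, e₂])
    (g11 g12 g22 g : ℝ)
    (hg11 : g11 = dot3 e₁ e₁) (hg12 : g12 = dot3 e₁ e₂)
    (hg22 : g22 = dot3 e₂ e₂) (hg : g = g11 * g22 - g12 ^ 2)
    (hcross : ∀ᶠ ξ in nhds (0 : Fin 2 → ℝ),
      cross3 (pd 0 x ξ) (pd 1 x ξ) ≠ 0)
    (n : (Fin 2 → ℝ) → (Fin 3 → ℝ))
    (hn : ∀ ξ, n ξ = (enorm3 (cross3 (pd 0 x ξ) (pd 1 x ξ)))⁻¹ •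
      cross3 (pd 0 x ξ) (pd 1 x ξ))
    (τ₁ τ₂ : Fin 3 → ℝ)
    (hτ₁ : τ₁ = (Real.sqrt (g / g22) / g) • (g22 • e₁ - g12 • e₂))
    (hτ₂ : τ₂ = (Real.sqrt (g / g11) / g) • (g11 • e₂ - g12 • e₁))
    -- second fundamental form coefficients L, M, N at 0
    (L M N : ℝ)
    (hL : L = dot3 (pd 0 (pd 0 x) 0) (n 0))
    (hM : M = dot3 (pd 0 (pd 1 x) 0) (n 0))
    (hN : N = dot3 (pd 1 (pd 1 x) 0) (n 0))
    (Φ210 Φ201 : (Fin 3 → ℝ) → ℝ)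
    (hΦ210 : ∀ y, Φ210 y = (2 / k ^ 2) * Real.sqrt (g22 / g) *
      Real.sin (k * dot3 (n 0) (y - p) / Real.sqrt 2) *
      Real.sin (k * dot3 τ₁ (y - p) / Real.sqrt 2))
    (hΦ201 : ∀ y, Φ201 y = (2 / k ^ 2) * Real.sqrt (g11 / g) *
      Real.sin (k * dot3 (n 0) (y - p) / Real.sqrt 2) *
      Real.sin (k * dot3 τ₂ (y - p) / Real.sqrt 2))
    (Φ Ψ : (Fin 3 → ℝ) → ℝ)
    (hΦ : ∀ y, Φ y = (1 / k) * Real.sqrt (g22 / g) * Real.sin (k * dot3 τ₁ (y - p))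
      - ((g12 * M - g22 * L) / g) * Φ210 y - ((g12 * N - g22 * M) / g) * Φ201 y)
    (hΨ : ∀ y, Ψ y = (1 / k) * Real.sqrt (g11 / g) * Real.sin (k * dot3 τ₂ (y - p))
      - ((g12 * L - g11 * M) / g) * Φ210 y - ((g12 * M - g11 * N) / g) * Φ201 y)
    (dΦ νΦ dΨ νΨ : (Fin 2 → ℝ) → ℝ)
    (hdΦ : ∀ ξ, dΦ ξ = Φ (x ξ)) (hνΦ : ∀ ξ, νΦ ξ = fderiv ℝ Φ (x ξ) (n ξ))
    (hdΨ : ∀ ξ, dΨ ξ = Ψ (x ξ)) (hνΨ : ∀ ξ, νΨ ξ = fderiv ℝ Ψ (x ξ) (n ξ)) :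
    (dΦ 0 = 0 ∧ pd 0 dΦ 0 = 1 ∧ pd 1 dΦ 0 = 0 ∧
     νΦ 0 = 0 ∧ pd 0 νΦ 0 = 0 ∧ pd 1 νΦ 0 = 0) ∧
    (dΨ 0 = 0 ∧ pd 0 dΨ 0 = 0 ∧ pd 1 dΨ 0 = 1 ∧
     νΨ 0 = 0 ∧ pd 0 νΨ 0 = 0 ∧ pd 1 νΨ 0 = 0) := by
  have hxd : DifferentiableAt ℝ x 0 := hx.differentiable (by norm_num) 0
  have hdv (i : Fin 2) : DifferentiableAt ℝ (pd i x) 0 := differentiable_pd hx i 0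
  have hc0 : cross3 (pd 0 x 0) (pd 1 x 0) ≠ 0 := hcross.self_of_nhds
  have hnd : DifferentiableAt ℝ n 0 := by
    rw [funext hn]
    exact differentiableAt_normalize (differentiableAt_cross3 (hdv 0) (hdv 1)) hc0
  have hnn : dot3 (n 0) (n 0) = 1 := by
    rw [hn]
    exact dot3_normalize_self hc0
  have hn₁ (ξ) : dot3 (pd 0 x ξ) (n ξ) = 0 := by
    rw [hn, dot3_comm, dot3_smul_left, dot3_cross3_left, mul_zero]
  have hn₂ (ξ) : dot3 (pd 1 x ξ) (n ξ) = 0 := by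
    rw [hn, dot3_comm, dot3_smul_left, dot3_cross3_right, mul_zero]
  have w₁₁ : dot3 e₁ (pd 0 n 0) = -L := by
    rw [he₁, hL]; exact dot3_fderiv_of_orthogonal (hdv 0) hnd hn₁ _
  have w₁₂ : dot3 e₁ (pd 1 n 0) = -M := by
    rw [he₁, hM, pd_comm hx]; exact dot3_fderiv_of_orthogonal (hdv 0) hnd hn₁ _
  have w₂₁ : dot3 e₂ (pd 0 n 0) = -M := by
    rw [he₂, hM]; exact dot3_fderiv_of_orthogonal (hdv 1) hnd hn₂ _
  have w₂₂ : dot3 e₂ (pd 1 n 0) = -N := by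
    rw [he₂, hN]; exact dot3_fderiv_of_orthogonal (hdv 1) hnd hn₂ _
  have o₁ : dot3 e₁ (n 0) = 0 := he₁ ▸ hn₁ 0
  have o₂ : dot3 e₂ (n 0) = 0 := he₂ ▸ hn₂ 0
  have hgpos : 0 < g := by
    rw [hg, hg11, hg12, hg22, ← dot3_cross3_self, he₁, he₂]
    exact dot3_self_pos hc0
  have hg11pos : 0 < g11 := by
    rw [hg11]
    exact dot3_self_pos (hind.ne_zero 0)
  have hg22pos : 0 < g22 := by
    rw [hg22]
    exact dot3_self_pos (hind.ne_zero 1)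
  have t₁ (v) := sqrt_mul_dual_dot3 hg22pos hgpos g12 e₁ e₂ v
  have t₂ (v) := sqrt_mul_dual_dot3 hg11pos hgpos g12 e₂ e₁ v
  rw [← hτ₁] at t₁
  rw [← hτ₂] at t₂
  set s₁ := Real.sqrt (g22 / g)
  set s₂ := Real.sqrt (g11 / g)
  have hg21 : dot3 e₂ e₁ = g12 := by rw [hg12, dot3_comm]
  have t₁e₁ : s₁ * dot3 τ₁ e₁ = 1 := by
    rw [t₁, ← hg11, hg21, div_eq_one_iff_eq hgpos.ne', hg]; ring
  have t₁e₂ : s₁ * dot3 τ₁ e₂ = 0 := by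
    rw [t₁, ← hg12, ← hg22]; ring
  have t₂e₁ : s₂ * dot3 τ₂ e₁ = 0 := by
    rw [t₂, ← hg11, hg21]; ring
  have t₂e₂ : s₂ * dot3 τ₂ e₂ = 1 := by
    rw [t₂, ← hg12, ← hg22, div_eq_one_iff_eq hgpos.ne', hg]; ring
  have t₁n : s₁ * dot3 τ₁ (n 0) = 0 := by rw [t₁, o₁, o₂]; ring
  have t₂n : s₂ * dot3 τ₂ (n 0) = 0 := by rw [t₂, o₁, o₂]; ring
  have hκ : 2 / k ^ 2 * (k / Real.sqrt 2) ^ 2 = 1 := by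
    rw [div_pow, Real.sq_sqrt (by norm_num)]
    field_simp
  have hk1 : 1 / k * k = 1 := by field_simp
  have key (s A B : ℝ) (a : Fin 3 → ℝ) (F : (Fin 3 → ℝ) → ℝ) (d ν : (Fin 2 → ℝ) → ℝ)
      (hF : ∀ y, F y = (1 / k) * s * Real.sin (k * dot3 a (y - p)) - A * Φ210 y - B * Φ201 y)
      (hd : ∀ ξ, d ξ = F (x ξ)) (hν : ∀ ξ, ν ξ = fderiv ℝ F (x ξ) (n ξ)) :
      d 0 = 0 ∧ pd 0 d 0 = s * dot3 a e₁ ∧ pd 1 d 0 = s * dot3 a e₂ ∧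
      ν 0 = s * dot3 a (n 0) ∧ pd 0 ν 0 = s * dot3 a (pd 0 n 0) - A ∧
      pd 1 ν 0 = s * dot3 a (pd 1 n 0) - B := by
    have hFw : F = waveSum p (n 0) a τ₁ τ₂ k (k / Real.sqrt 2) (1 / k * s)
        (A * (2 / k ^ 2) * s₁) (B * (2 / k ^ 2) * s₂) := by
      ext y
      rw [hF, hΦ210, hΦ201, waveSum]
      simp only [mul_div_right_comm k]
      ring
    rw [funext hd, funext hν, hFw]
    have hN (w : Fin 2 → ℝ) := fderiv_neumann_waveSum_apply p (n 0) a τ₁ τ₂ k (k / Real.sqrt 2)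
      (1 / k * s) (A * (2 / k ^ 2) * s₁) (B * (2 / k ^ 2) * s₂) hxd hnd hxp w
    have hD (w : Fin 2 → ℝ) := fderiv_waveSum_comp_apply p (n 0) a τ₁ τ₂ k (k / Real.sqrt 2)
      (1 / k * s) (A * (2 / k ^ 2) * s₁) (B * (2 / k ^ 2) * s₂) hxd w
    have ho₁ : dot3 (n 0) e₁ = 0 := by rw [dot3_comm, o₁]
    have ho₂ : dot3 (n 0) e₂ = 0 := by rw [dot3_comm, o₂]
    have h₁ : fderiv ℝ x 0 (Pi.single 0 1) = e₁ := he₁.symm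
    have h₂ : fderiv ℝ x 0 (Pi.single 1 1) = e₂ := he₂.symm
    refine ⟨?_, ?_, ?_, ?_, ?_, ?_⟩
    · beta_reduce
      rw [hxp, waveSum_self]
    · rw [pd, hD, hxp, fderiv_self_waveSum_apply, h₁]
      linear_combination s * dot3 a e₁ * hk1
    · rw [pd, hD, hxp, fderiv_self_waveSum_apply, h₂]
      linear_combination s * dot3 a e₂ * hk1
    · beta_reduce
      rw [hxp, fderiv_self_waveSum_apply]
      linear_combination s * dot3 a (n 0) * hk1
    · rw [pd, hN, h₁, hnn, ho₁, pd]
      linear_combination s * dot3 a (fderiv ℝ n 0 (Pi.single 0 1)) * hk1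
        - (A * s₁ * dot3 τ₁ e₁ + B * s₂ * dot3 τ₂ e₁) * hκ - A * t₁e₁ - B * t₂e₁
    · rw [pd, hN, h₂, hnn, ho₂, pd]
      linear_combination s * dot3 a (fderiv ℝ n 0 (Pi.single 1 1)) * hk1
        - (A * s₁ * dot3 τ₁ e₂ + B * s₂ * dot3 τ₂ e₂) * hκ - A * t₁e₂ - B * t₂e₂
  obtain ⟨a₁, a₂, a₃, a₄, a₅, a₆⟩ := key _ _ _ _ Φ dΦ νΦ hΦ hdΦ hνΦ
  obtain ⟨b₁, b₂, b₃, b₄, b₅, b₆⟩ := key _ _ _ _ Ψ dΨ νΨ hΨ hdΨ hνΨ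
  refine ⟨⟨a₁, a₂.trans t₁e₁, a₃.trans t₁e₂, a₄.trans t₁n, ?_, ?_⟩,
    ⟨b₁, b₂.trans t₂e₁, b₃.trans t₂e₂, b₄.trans t₂n, ?_, ?_⟩⟩
  · rw [a₅, t₁, w₁₁, w₂₁]; ring
  · rw [a₆, t₁, w₁₂, w₂₂]; ring
  · rw [b₅, t₂, w₁₁, w₂₁]; ring
  · rw [b₆, t₂, w₁₂, w₂₂]; ring

end Stmt3
end
end
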